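/- For every set A of positive integers, the zeta-dimension of A equals the limit superior, as n → ∞, of log|A ∩ {2^n, …, 2^{n+1} − 1}| / n (where log denotes the base-2 logarithm). -/

import Mathlib

open Filter

/-- The zeta-dimension of a set of positive integers:
`Dim_ζ(A) = inf { s ∈ [0,∞) : Σ_{n ∈ A} n^{-s} < ∞ }`. -/
noncomputable def zetaDim (A : Set ℕ+) : ℝ :=
  sInf {s : ℝ | 0 ≤ s ∧ (∑' n : A, (((n : ℕ+) : ℕ) : ENNReal) ^ (-s)) < ⊤}

/-- The part of `A` lying in `{2 ^ n, …, 2 ^ (n + 1) - 1}`. -/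
def dyadicBlock (A : Set ℕ+) (n : ℕ) : Set ℕ+ :=
  {m : ℕ+ | m ∈ A ∧ 2 ^ n ≤ (m : ℕ) ∧ (m : ℕ) ≤ 2 ^ (n + 1) - 1}

lemma dyadicBlock_subset (A : Set ℕ+) (n : ℕ) : dyadicBlock A n ⊆ A := fun _ h => h.1

lemma iUnion_dyadicBlock (A : Set ℕ+) : ⋃ n, dyadicBlock A n = A := by
  refine Set.Subset.antisymm (Set.iUnion_subset (dyadicBlock_subset A)) fun m hm => ?_
  refine Set.mem_iUnion.2 ⟨Nat.log 2 m, hm, Nat.pow_log_le_self 2 m.pos.ne', ?_⟩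
  exact Nat.le_sub_one_of_lt (Nat.lt_pow_succ_log_self one_lt_two _)

lemma encard_dyadicBlock_le (A : Set ℕ+) (n : ℕ) : (dyadicBlock A n).encard ≤ (2 ^ n : ℕ) := by
  have h : ((↑) : ℕ+ → ℕ) '' dyadicBlock A n ⊆ (Finset.Ico (2 ^ n) (2 ^ (n + 1)) : Finset ℕ) := by
    rintro _ ⟨m, ⟨-, h1, h2⟩, rfl⟩
    have := Nat.one_le_two_pow (n := n + 1)
    simp only [Finset.coe_Ico, Set.mem_Ico]
    omega
  have h' := Set.encard_le_encard h
  rw [PNat.coe_injective.encard_image, Set.encard_coe_eq_coe_finsetCard, Nat.card_Ico] at h'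
  convert h' using 2
  rw [pow_succ]
  omega

lemma finite_dyadicBlock (A : Set ℕ+) (n : ℕ) : (dyadicBlock A n).Finite :=
  Set.finite_of_encard_le_coe (encard_dyadicBlock_le A n)

lemma ncard_dyadicBlock_le (A : Set ℕ+) (n : ℕ) : (dyadicBlock A n).ncard ≤ 2 ^ n := by
  have h := encard_dyadicBlock_le A n
  rw [← (finite_dyadicBlock A n).cast_ncard_eq] at h
  exact_mod_cast h

lemma ENNReal.natCast_rpow_eq_ofReal {k : ℕ} (hk : 0 < k) (s : ℝ) :
    (k : ENNReal) ^ s = ENNReal.ofReal ((k : ℝ) ^ s) := by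
  rw [← ENNReal.ofReal_rpow_of_pos (by exact_mod_cast hk), ENNReal.ofReal_natCast]

lemma tsum_dyadicBlock_const (A : Set ℕ+) (n : ℕ) {c : ℝ} :
    ∑' _ : dyadicBlock A n, ENNReal.ofReal c =
      ENNReal.ofReal ((dyadicBlock A n).ncard * c) := by
  rw [ENNReal.tsum_set_const, ← (finite_dyadicBlock A n).cast_ncard_eq,
    ENNReal.ofReal_mul (Nat.cast_nonneg _), ENNReal.ofReal_natCast]
  simp

lemma tsum_dyadicBlock_le (A : Set ℕ+) (n : ℕ) {s : ℝ} (hs : 0 ≤ s) :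
    ∑' m : dyadicBlock A n, (((m : ℕ+) : ℕ) : ENNReal) ^ (-s) ≤
      ENNReal.ofReal ((dyadicBlock A n).ncard * ((2 : ℝ) ^ n) ^ (-s)) := by
  rw [← tsum_dyadicBlock_const]
  refine ENNReal.tsum_le_tsum fun ⟨m, _, hm, _⟩ => ?_
  rw [ENNReal.natCast_rpow_eq_ofReal m.pos]
  refine ENNReal.ofReal_le_ofReal (Real.rpow_le_rpow_of_nonpos (by positivity) ?_ (by linarith))
  exact_mod_cast hm

lemma le_tsum_dyadicBlock (A : Set ℕ+) (n : ℕ) {s : ℝ} (hs : 0 ≤ s) :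
    ENNReal.ofReal ((dyadicBlock A n).ncard * ((2 : ℝ) ^ (n + 1)) ^ (-s)) ≤
      ∑' m : dyadicBlock A n, (((m : ℕ+) : ℕ) : ENNReal) ^ (-s) := by
  rw [← tsum_dyadicBlock_const]
  refine ENNReal.tsum_le_tsum fun ⟨m, _, _, hm⟩ => ?_
  rw [ENNReal.natCast_rpow_eq_ofReal m.pos]
  refine ENNReal.ofReal_le_ofReal (Real.rpow_le_rpow_of_nonpos ?_ ?_ (by linarith))
  · exact_mod_cast m.pos
  · exact_mod_cast hm.trans (Nat.sub_le _ _)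

/-- The exponential growth rate of `A` on its `n`-th dyadic block. -/
noncomputable def dyadicRate (A : Set ℕ+) (n : ℕ) : ℝ :=
  Real.logb 2 (dyadicBlock A n).ncard / n

lemma logb_two_natCast_nonneg (k : ℕ) : 0 ≤ Real.logb 2 k :=
  div_nonneg (Real.log_natCast_nonneg k) (Real.log_nonneg one_le_two)

lemma dyadicRate_nonneg (A : Set ℕ+) (n : ℕ) : 0 ≤ dyadicRate A n :=
  div_nonneg (logb_two_natCast_nonneg _) (Nat.cast_nonneg n)

lemma dyadicRate_le_one (A : Set ℕ+) (n : ℕ) : dyadicRate A n ≤ 1 := by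
  refine div_le_one_of_le₀ ?_ (Nat.cast_nonneg n)
  rcases Nat.eq_zero_or_pos (dyadicBlock A n).ncard with h | h
  · simp [h]
  · rw [Real.logb_le_iff_le_rpow one_lt_two (by exact_mod_cast h), Real.rpow_natCast]
    exact_mod_cast ncard_dyadicBlock_le A n

lemma isBoundedUnder_dyadicRate (A : Set ℕ+) :
    IsBoundedUnder (· ≤ ·) atTop (dyadicRate A) :=
  isBoundedUnder_of ⟨1, dyadicRate_le_one A⟩

lemma isCoboundedUnder_dyadicRate (A : Set ℕ+) :
    IsCoboundedUnder (· ≤ ·) atTop (dyadicRate A) :=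
  (isBoundedUnder_of ⟨0, dyadicRate_nonneg A⟩ :
    IsBoundedUnder (· ≥ ·) atTop (dyadicRate A)).isCoboundedUnder_le

lemma limsup_dyadicRate_nonneg (A : Set ℕ+) : 0 ≤ limsup (dyadicRate A) atTop :=
  le_limsup_of_frequently_le (Frequently.of_forall (dyadicRate_nonneg A))
    (isBoundedUnder_dyadicRate A)

lemma ncard_dyadicBlock_le_of_dyadicRate_le {A : Set ℕ+} {n : ℕ} {t : ℝ} (hn : 0 < n)
    (h : dyadicRate A n ≤ t) : ((dyadicBlock A n).ncard : ℝ) ≤ (2 : ℝ) ^ (t * n) := by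
  rcases Nat.eq_zero_or_pos (dyadicBlock A n).ncard with h0 | h0
  · rw [h0, Nat.cast_zero]
    positivity
  · rw [← Real.logb_le_iff_le_rpow one_lt_two (by exact_mod_cast h0)]
    exact (div_le_iff₀ (by exact_mod_cast hn)).1 h

lemma tsum_lt_top_of_limsup_dyadicRate_lt {A : Set ℕ+} {s : ℝ}
    (hs : limsup (dyadicRate A) atTop < s) :
    ∑' n : A, (((n : ℕ+) : ℕ) : ENNReal) ^ (-s) < ⊤ := by
  have hs0 : 0 ≤ s := (limsup_dyadicRate_nonneg A).trans hs.le
  obtain ⟨t, ht, hts⟩ := exists_between hs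
  have hev := eventually_lt_of_limsup_lt ht (isBoundedUnder_dyadicRate A)
  have hsum : Summable fun n : ℕ =>
      ((dyadicBlock A n).ncard : ℝ) * ((2 : ℝ) ^ n) ^ (-s) := by
    refine Summable.of_norm_bounded_eventually_nat (g := fun n => ((2 : ℝ) ^ (t - s)) ^ n)
      (summable_geometric_of_lt_one (by positivity)
        (Real.rpow_lt_one_of_one_lt_of_neg one_lt_two (by linarith))) ?_
    filter_upwards [hev, eventually_gt_atTop 0] with n hn hn0
    rw [Real.norm_of_nonneg (by positivity)]
    calc ((dyadicBlock A n).ncard : ℝ) * ((2 : ℝ) ^ n) ^ (-s)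
        ≤ (2 : ℝ) ^ (t * n) * ((2 : ℝ) ^ n) ^ (-s) := by
          gcongr
          exact ncard_dyadicBlock_le_of_dyadicRate_le hn0 hn.le
      _ = ((2 : ℝ) ^ (t - s)) ^ n := by
          rw [← Real.rpow_natCast, ← Real.rpow_mul zero_le_two, ← Real.rpow_add two_pos,
            ← Real.rpow_natCast, ← Real.rpow_mul zero_le_two]
          ring_nf
  calc ∑' n : A, (((n : ℕ+) : ℕ) : ENNReal) ^ (-s)
      = ∑' n : ⋃ n, dyadicBlock A n, (((n : ℕ+) : ℕ) : ENNReal) ^ (-s) := by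
        rw [iUnion_dyadicBlock]
    _ ≤ ∑' n, ∑' m : dyadicBlock A n, (((m : ℕ+) : ℕ) : ENNReal) ^ (-s) :=
        ENNReal.tsum_iUnion_le_tsum (fun m : ℕ+ => ((m : ℕ) : ENNReal) ^ (-s)) _
    _ ≤ ∑' n, ENNReal.ofReal ((dyadicBlock A n).ncard * ((2 : ℝ) ^ n) ^ (-s)) :=
        ENNReal.tsum_le_tsum fun n => tsum_dyadicBlock_le A n hs0
    _ < ⊤ := hsum.tsum_ofReal_lt_top

lemma limsup_dyadicRate_le_of_tsum_lt_top {A : Set ℕ+} {s : ℝ} (hs : 0 ≤ s)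
    (h : ∑' n : A, (((n : ℕ+) : ℕ) : ENNReal) ^ (-s) < ⊤) :
    limsup (dyadicRate A) atTop ≤ s := by
  obtain ⟨M, hM1, hM⟩ : ∃ M : ℝ, 1 ≤ M ∧
      ∀ n, ((dyadicBlock A n).ncard : ℝ) * ((2 : ℝ) ^ (n + 1)) ^ (-s) ≤ M := by
    refine ⟨max 1 (∑' n : A, (((n : ℕ+) : ℕ) : ENNReal) ^ (-s)).toReal, le_max_left _ _,
      fun n => le_max_of_le_right ?_⟩
    rw [← ENNReal.ofReal_le_iff_le_toReal h.ne]
    exact (le_tsum_dyadicBlock A n hs).trans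
      (ENNReal.tsum_mono_subtype (fun m : ℕ+ => ((m : ℕ) : ENNReal) ^ (-s))
        (dyadicBlock_subset A n))
  have hbound : ∀ n, Real.logb 2 (dyadicBlock A n).ncard ≤ Real.logb 2 M + s * (n + 1) := by
    intro n
    have hM0 : 0 ≤ Real.logb 2 M := Real.logb_nonneg one_lt_two hM1
    rcases Nat.eq_zero_or_pos (dyadicBlock A n).ncard with h0 | h0
    · rw [h0, Nat.cast_zero, Real.logb_zero]
      positivity
    · rw [Real.logb_le_iff_le_rpow one_lt_two (by exact_mod_cast h0), Real.rpow_add two_pos,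
        Real.rpow_logb two_pos (by norm_num) (by linarith)]
      have hn := hM n
      rw [Real.rpow_neg (by positivity), ← div_eq_mul_inv, div_le_iff₀ (by positivity),
        ← Real.rpow_natCast, ← Real.rpow_mul zero_le_two, mul_comm _ s] at hn
      exact_mod_cast hn
  have hlim : Tendsto (fun n : ℕ => (Real.logb 2 M + s) / n + s) atTop (nhds s) := by
    simpa using (tendsto_const_div_atTop_nhds_zero_nat (Real.logb 2 M + s)).add_const s
  rw [← hlim.limsup_eq]
  refine limsup_le_limsup ?_ (isCoboundedUnder_dyadicRate A) hlim.isBoundedUnder_le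
  filter_upwards [eventually_gt_atTop 0] with n hn
  have hn' : (0 : ℝ) < n := by exact_mod_cast hn
  rw [dyadicRate, div_le_iff₀ hn', add_mul, div_mul_cancel₀ _ hn'.ne']
  linarith [hbound n]

theorem zetaDim_eq_limsup_dyadic_block (A : Set ℕ+) :
    zetaDim A =
      atTop.limsup (fun n : ℕ =>
        Real.logb 2
          ((Set.ncard {m : ℕ+ | m ∈ A ∧ 2 ^ n ≤ (m : ℕ) ∧ (m : ℕ) ≤ 2 ^ (n + 1) - 1} : ℕ)) / n) := by
  change zetaDim A = limsup (dyadicRate A) atTop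
  have hmem : ∀ s, limsup (dyadicRate A) atTop < s →
      s ∈ {s : ℝ | 0 ≤ s ∧ (∑' n : A, (((n : ℕ+) : ℕ) : ENNReal) ^ (-s)) < ⊤} := fun s hs =>
    ⟨(limsup_dyadicRate_nonneg A).trans hs.le, tsum_lt_top_of_limsup_dyadicRate_lt hs⟩
  apply le_antisymm
  · exact le_of_forall_gt_imp_ge_of_dense fun s hs => csInf_le ⟨0, fun _ hx => hx.1⟩ (hmem s hs)
  · exact le_csInf ⟨_, hmem _ (lt_add_one _)⟩ fun s hs =>
      limsup_dyadicRate_le_of_tsum_lt_top hs.1 hs.2
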